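/- Let g be Hardy class from below of order 2 with Schwartz restriction to the real axis, and let z_R ∈ ℂ with Im z_R < 0. Then ∫_ℝ t·g(t)/(t − z_R) dt = −2πi z_R g(z_R) = z_R ∫_ℝ g(t)/(t − z_R) dt. (Generalized eigenvalue identity for the invariant mass-squared operator: multiplication by the variable inside the Breit-Wigner integral pulls out the complex pole value z_R.) -/

import Mathlib

open MeasureTheory Filter

/-- `f : ℂ → ℂ` is Hardy class from below of order `p`: analytic on the open lower
half-plane, continuous on the closed lower half-plane, and the `L^p` norms of the
horizontal sections `x ↦ f (x + iy)`, `y < 0`, are uniformly bounded. -/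
def HardyBelow (p : ℝ) (f : ℂ → ℂ) : Prop :=
  DifferentiableOn ℂ f {z : ℂ | z.im < 0} ∧
  ContinuousOn f {z : ℂ | z.im ≤ 0} ∧
  ∃ M : ℝ, ∀ y : ℝ, y < 0 →
    Integrable (fun x : ℝ => ‖f (↑x + ↑y * Complex.I)‖ ^ p) ∧
    ∫ x : ℝ, ‖f (↑x + ↑y * Complex.I)‖ ^ p ≤ M

open Set Topology

theorem integrable_inv_sub_sq_add_sq (u : ℝ) {v : ℝ} (hv : v ≠ 0) :
    Integrable fun x : ℝ => ((x - u) ^ 2 + v ^ 2)⁻¹ := by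
  convert (((integrable_inv_one_add_sq.comp_mul_left' (inv_ne_zero hv)).comp_sub_right
    u).const_mul (v ^ 2)⁻¹) using 2 with x
  rw [← mul_inv]
  congr 1
  field_simp
  ring

theorem integral_inv_sub_sq_add_sq (u : ℝ) {v : ℝ} (hv : v ≠ 0) :
    ∫ x : ℝ, ((x - u) ^ 2 + v ^ 2)⁻¹ = Real.pi / |v| := by
  have h : ∀ x : ℝ, ((x - u) ^ 2 + v ^ 2)⁻¹ = (v ^ 2)⁻¹ * (1 + (v⁻¹ * (x - u)) ^ 2)⁻¹ := by
    intro x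
    rw [← mul_inv]
    congr 1
    field_simp
    ring
  simp_rw [h]
  rw [integral_const_mul, integral_sub_right_eq_self (fun x : ℝ => (1 + (v⁻¹ * x) ^ 2)⁻¹) u,
    Measure.integral_comp_mul_left (fun x : ℝ => (1 + x ^ 2)⁻¹), integral_univ_inv_one_add_sq,
    inv_inv, smul_eq_mul, ← sq_abs]
  have := abs_pos.mpr hv
  field_simp

/-- An integrable function takes arbitrarily small values arbitrarily far out. -/
theorem MeasureTheory.Integrable.frequently_lt {φ : ℝ → ℝ} (hφ : Integrable φ) {ε : ℝ}
    (hε : 0 < ε) : ∃ᶠ x in atTop, φ x < ε := by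
  intro h
  obtain ⟨a, ha⟩ := eventually_atTop.mp h
  have hc : IntegrableOn (fun _ : ℝ => ε) (Ici a) := by
    refine hφ.integrableOn.mono' aestronglyMeasurable_const ?_
    filter_upwards [ae_restrict_mem measurableSet_Ici] with x hx
    rw [Real.norm_of_nonneg hε.le]
    exact not_lt.mp (ha x hx)
  rw [integrableOn_const_iff] at hc
  simp [hε.ne'] at hc

theorem Complex.norm_sub_sq (t z : ℂ) : ‖t - z‖ ^ 2 = (t.re - z.re) ^ 2 + (t.im - z.im) ^ 2 := by
  rw [Complex.sq_norm, Complex.normSq_apply]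
  simp only [Complex.sub_re, Complex.sub_im]
  ring

/-- Weighted AM-GM bound for a quotient by `t - z`. -/
theorem norm_le_of_sub_mul_eq {t z a b : ℂ} (hne : t ≠ z) (h : (t - z) * a = b) {s : ℝ}
    (hs : 0 < s) :
    ‖a‖ ≤ (s * ‖b‖ ^ 2 + s⁻¹ * ((t.re - z.re) ^ 2 + (t.im - z.im) ^ 2)⁻¹) / 2 := by
  have hpos : 0 < ‖t - z‖ := norm_pos_iff.mpr (sub_ne_zero.mpr hne)
  rw [← Complex.norm_sub_sq, ← h, norm_mul]
  have key : s * (‖t - z‖ * ‖a‖) ^ 2 + s⁻¹ * (‖t - z‖ ^ 2)⁻¹ - 2 * ‖a‖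
      = s⁻¹ * (s * ‖t - z‖ * ‖a‖ - ‖t - z‖⁻¹) ^ 2 := by
    field_simp
    ring
  have : 0 ≤ s⁻¹ * (s * ‖t - z‖ * ‖a‖ - ‖t - z‖⁻¹) ^ 2 := by positivity
  linarith

namespace HardyBelow

variable {h F : ℂ → ℂ} {z : ℂ}

theorem exists_integral_sq_le (hh : HardyBelow 2 h) : ∃ M : ℝ, ∀ y : ℝ, y < 0 →
    Integrable (fun x : ℝ => ‖h (x + y * Complex.I)‖ ^ 2) ∧
    ∫ x : ℝ, ‖h (x + y * Complex.I)‖ ^ 2 ≤ M := by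
  simpa only [Real.rpow_two] using hh.2.2

theorem integrable_strip (hh : HardyBelow 2 h) (Y : ℝ) :
    Integrable (fun q : ℝ × ℝ => ‖h (q.1 + q.2 * Complex.I)‖ ^ 2)
      (volume.prod (volume.restrict (Ioo (-Y) 0))) := by
  obtain ⟨M, hM⟩ := hh.exists_integral_sq_le
  have hmeas : AEStronglyMeasurable (fun q : ℝ × ℝ => ‖h (q.1 + q.2 * Complex.I)‖ ^ 2)
      (volume.prod (volume.restrict (Ioo (-Y) 0))) := by
    have hc : ContinuousOn (fun q : ℝ × ℝ => ‖h (q.1 + q.2 * Complex.I)‖ ^ 2)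
        (univ ×ˢ Ioo (-Y) 0) := by
      refine ((hh.2.1.comp (by fun_prop) ?_).norm).pow 2
      rintro ⟨x, y⟩ hq
      simpa using hq.2.2.le
    have := hc.aestronglyMeasurable (μ := volume.prod volume)
      (MeasurableSet.univ.prod measurableSet_Ioo)
    rwa [← Measure.prod_restrict, Measure.restrict_univ] at this
  rw [integrable_prod_iff' hmeas]
  refine ⟨?_, ?_⟩
  · filter_upwards [ae_restrict_mem measurableSet_Ioo] with y hy using (hM y hy.2).1
  · refine Integrable.mono' (g := fun _ => M) (integrable_const _)
      hmeas.norm.prod_swap.integral_prod_right' ?_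
    filter_upwards [ae_restrict_mem measurableSet_Ioo] with y hy
    rw [Real.norm_of_nonneg (integral_nonneg fun _ => norm_nonneg _)]
    simpa using (hM y hy.2).2

theorem norm_integral_vertical_le (hh : HardyBelow 2 h)
    (hFh : ∀ t : ℂ, t.im ≤ 0 → (t - z) * F t = h t) {Y x : ℝ} (hY : 0 ≤ Y) (hx : x ≠ z.re) :
    ‖∫ y in -Y..0, F (x + y * Complex.I)‖ ≤
      ((∫ y in Ioo (-Y) 0, ‖h (x + y * Complex.I)‖ ^ 2) + Y * ((x - z.re) ^ 2)⁻¹) / 2 := by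
  have hx2 : 0 < (x - z.re) ^ 2 := by have := sub_ne_zero.mpr hx; positivity
  have hi : IntervalIntegrable (fun y : ℝ => ‖h (x + y * Complex.I)‖ ^ 2) volume (-Y) 0 := by
    apply ContinuousOn.intervalIntegrable
    refine ((hh.2.1.comp (by fun_prop) ?_).norm).pow 2
    intro y hy
    rw [uIcc_of_le (by linarith)] at hy
    simpa using hy.2
  have hi' : IntervalIntegrable (fun y : ℝ =>
      (‖h (x + y * Complex.I)‖ ^ 2 + ((x - z.re) ^ 2)⁻¹) / 2) volume (-Y) 0 :=
    (hi.add intervalIntegrable_const).div_const 2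
  refine (intervalIntegral.norm_integral_le_of_norm_le (by linarith) ?_ hi').trans ?_
  · refine .of_forall fun y hy => ?_
    have hne : (x + y * Complex.I : ℂ) ≠ z := fun e => hx (by simp [← e])
    refine (norm_le_of_sub_mul_eq hne (hFh _ (by simpa using hy.2)) one_pos).trans ?_
    have : ((x - z.re) ^ 2 + (y - z.im) ^ 2)⁻¹ ≤ ((x - z.re) ^ 2)⁻¹ := by
      gcongr
      nlinarith [sq_nonneg (y - z.im)]
    simp
    linarith
  · rw [intervalIntegral.integral_div, intervalIntegral.integral_add hi intervalIntegrable_const,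
      intervalIntegral.integral_const, intervalIntegral.integral_of_le (by linarith : -Y ≤ 0),
      integral_Ioc_eq_integral_Ioo]
    simp

theorem norm_integral_horizontal_le {M : ℝ} (hM : ∀ y : ℝ, y < 0 →
      Integrable (fun x : ℝ => ‖h (x + y * Complex.I)‖ ^ 2) ∧
      ∫ x : ℝ, ‖h (x + y * Complex.I)‖ ^ 2 ≤ M)
    (hFh : ∀ t : ℂ, t.im ≤ 0 → (t - z) * F t = h t) {Y R s : ℝ} (hY : 0 < Y) (hYz : 0 < Y + z.im)
    (hR : 0 ≤ R) (hs : 0 < s) :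
    ‖∫ x in -R..R, F (x + (-Y : ℝ) * Complex.I)‖ ≤
      (s * M + s⁻¹ * (Real.pi / (Y + z.im))) / 2 := by
  have h1 := hM (-Y) (by linarith)
  have h2 := integrable_inv_sub_sq_add_sq z.re hYz.ne'
  have hi : Integrable (fun x : ℝ => (s * ‖h (x + (-Y : ℝ) * Complex.I)‖ ^ 2 +
      s⁻¹ * ((x - z.re) ^ 2 + (Y + z.im) ^ 2)⁻¹) / 2) :=
    ((h1.1.const_mul s).add (h2.const_mul s⁻¹)).div_const 2
  refine (intervalIntegral.norm_integral_le_of_norm_le (by linarith) ?_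
    hi.intervalIntegrable).trans ?_
  · refine .of_forall fun x _ => ?_
    have hne : (x + (-Y : ℝ) * Complex.I : ℂ) ≠ z := fun e => by
      have := congrArg Complex.im e
      simp at this
      linarith
    refine (norm_le_of_sub_mul_eq hne (hFh _ (by simpa using hY.le)) hs).trans (le_of_eq ?_)
    simp
    left
    ring
  · rw [intervalIntegral.integral_of_le (by linarith)]
    refine (setIntegral_le_integral hi (.of_forall fun x => by positivity)).trans ?_
    rw [integral_div, integral_add (h1.1.const_mul s) (h2.const_mul s⁻¹), integral_const_mul,
      integral_const_mul, integral_inv_sub_sq_add_sq _ hYz.ne', abs_of_pos hYz]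
    gcongr
    exact h1.2

/-- Cauchy's theorem on the lower half-plane for a quotient of a Hardy function by `t - z`. -/
theorem integral_eq_zero (hh : HardyBelow 2 h) (hFd : DifferentiableOn ℂ F {t | t.im < 0})
    (hFc : ContinuousOn F {t | t.im ≤ 0})
    (hFh : ∀ t : ℂ, t.im ≤ 0 → (t - z) * F t = h t)
    (hFi : Integrable fun x : ℝ => F x) : ∫ x : ℝ, F x = 0 := by
  obtain ⟨M, hM⟩ := hh.exists_integral_sq_le
  have hrect : ∀ {Y R : ℝ}, 0 < Y → 0 < R → ‖∫ x in -R..R, F x‖ ≤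
      ‖∫ x in -R..R, F (x + (-Y : ℝ) * Complex.I)‖ + ‖∫ y in -Y..0, F (R + y * Complex.I)‖
        + ‖∫ y in -Y..0, F ((-R : ℝ) + y * Complex.I)‖ := by
    intro Y R hY hR
    have hc := Complex.integral_boundary_rect_eq_zero_of_continuousOn_of_differentiableOn F
      ⟨-R, -Y⟩ ⟨R, 0⟩ (hFc.mono ?_) (hFd.mono ?_)
    · simp only [Complex.ofReal_zero, zero_mul, add_zero, smul_eq_mul] at hc
      have e : (∫ x in -R..R, F x) = (∫ x in -R..R, F (x + (-Y : ℝ) * Complex.I)) +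
          Complex.I * (∫ y in -Y..0, F (R + y * Complex.I)) -
          Complex.I * (∫ y in -Y..0, F ((-R : ℝ) + y * Complex.I)) := by
        linear_combination -hc
      rw [e]
      refine (norm_sub_le _ _).trans ?_
      rw [norm_mul, Complex.norm_I, one_mul]
      gcongr
      refine (norm_add_le _ _).trans ?_
      rw [norm_mul, Complex.norm_I, one_mul]
    · intro t ht
      have := ht.2
      simp only [mem_preimage, uIcc_of_le (neg_nonpos.mpr hY.le)] at this
      exact this.2
    · intro t ht
      have := ht.2
      simp only [mem_preimage, max_eq_right (neg_nonpos.mpr hY.le)] at this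
      exact this.2
  have hbound : ∀ {Y s : ℝ}, 0 < Y → 0 < Y + z.im → 0 < s →
      ‖∫ x : ℝ, F x‖ ≤ (s * M + s⁻¹ * (Real.pi / (Y + z.im))) / 2 := by
    intro Y s hY hYz hs
    refine le_of_forall_pos_le_add fun ε hε => ?_
    have hlim := (intervalIntegral_tendsto_integral hFi tendsto_neg_atTop_atBot tendsto_id).norm
    refine le_of_tendsto_of_frequently hlim ?_
    have hφ := (hh.integrable_strip Y).integral_prod_left
    have hfreq := (hφ.add hφ.comp_neg).frequently_lt hε
    have htail : Tendsto (fun R : ℝ => Y * ((R - z.re) ^ 2)⁻¹ + Y * ((-R - z.re) ^ 2)⁻¹)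
        atTop (𝓝 0) := by
      have h1 : Tendsto (fun R : ℝ => (R - z.re) ^ 2) atTop atTop :=
        (tendsto_pow_atTop two_ne_zero).comp (tendsto_atTop_add_const_right _ _ tendsto_id)
      have h2 : Tendsto (fun R : ℝ => (-R - z.re) ^ 2) atTop atTop := by
        have := (tendsto_pow_atTop (α := ℝ) two_ne_zero).comp
          (tendsto_atTop_add_const_right _ z.re tendsto_id)
        refine this.congr fun R => ?_
        simp only [Function.comp, id]
        ring
      simpa using (h1.inv_tendsto_atTop.const_mul Y).add (h2.inv_tendsto_atTop.const_mul Y)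
    refine (hfreq.and_eventually ((htail.eventually_lt_const hε).and
      ((eventually_gt_atTop |z.re|).and (eventually_gt_atTop 0)))).mono ?_
    rintro R ⟨hR1, hR2, hR3, hR0⟩
    have hz := abs_lt.mp hR3
    have a1 := norm_integral_horizontal_le hM hFh hY hYz hR0.le hs
    have a2 := hh.norm_integral_vertical_le hFh hY.le hz.2.ne'
    have a3 := hh.norm_integral_vertical_le hFh hY.le hz.1.ne
    have a4 := hrect hY hR0
    simp only [Pi.add_apply] at hR1
    simp only [id]
    linarith
  have hlim : Tendsto (fun a : ℝ => (a⁻¹ * M + a * (Real.pi / (a ^ 2 - z.im + z.im))) / 2)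
      atTop (𝓝 0) := by
    have : Tendsto (fun a : ℝ => a⁻¹ * ((M + Real.pi) / 2)) atTop (𝓝 0) := by
      simpa using tendsto_inv_atTop_zero.mul_const ((M + Real.pi) / 2)
    refine this.congr' ?_
    filter_upwards [eventually_gt_atTop 0] with a ha
    rw [sub_add_cancel]
    field_simp
  refine norm_le_zero_iff.mp (ge_of_tendsto hlim ?_)
  filter_upwards [eventually_gt_atTop 0,
    (tendsto_pow_atTop two_ne_zero).eventually_gt_atTop z.im] with a ha ha2
  have := hbound (Y := a ^ 2 - z.im) (s := a⁻¹) (by linarith) (by rw [sub_add_cancel]; positivity)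
    (by positivity)
  rwa [inv_inv] at this

end HardyBelow

theorem Complex.ofReal_sub_ne_zero {w : ℂ} (hw : w.im ≠ 0) (x : ℝ) : (x : ℂ) - w ≠ 0 :=
  sub_ne_zero.mpr fun e => hw (by simp [← e])

theorem MeasureTheory.Integrable.div_ofReal_sub {f : ℝ → ℂ} (hf : Integrable f) {w : ℂ}
    (hw : w.im ≠ 0) : Integrable fun x : ℝ => f x / (x - w) := by
  simp_rw [div_eq_mul_inv]
  refine hf.mul_bdd (c := |w.im|⁻¹) (Continuous.aestronglyMeasurable ?_) (.of_forall fun x => ?_)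
  · exact Continuous.inv₀ (by fun_prop) (Complex.ofReal_sub_ne_zero hw)
  · rw [norm_inv]
    gcongr
    simpa using Complex.abs_im_le_norm ((x : ℂ) - w)

namespace HardyBelow

variable {h g : ℂ → ℂ}

/-- The integral of a Hardy function along the real axis vanishes. -/
theorem integral_ofReal_eq_zero (hh : HardyBelow 2 h) (hi : Integrable fun x : ℝ => h x) :
    ∫ x : ℝ, h x = 0 := by
  have hne : ∀ {N : ℝ}, 0 < N → ∀ t : ℂ, t.im ≤ 0 → t - N * Complex.I ≠ 0 := by
    intro N hN t ht e
    have := congrArg Complex.im e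
    simp at this
    linarith
  have hzero : ∀ N : ℝ, 0 < N → ∫ x : ℝ, h x * (-(N * Complex.I) / (x - N * Complex.I)) = 0 := by
    intro N hN
    have h0 : ∫ x : ℝ, h x / ((x : ℂ) - N * Complex.I) = 0 := by
      refine hh.integral_eq_zero (F := fun t => h t / (t - N * Complex.I)) (z := N * Complex.I)
        ?_ ?_ ?_ ?_
      · exact hh.1.div (by fun_prop) fun t ht => hne hN t (le_of_lt ht)
      · exact hh.2.1.div (by fun_prop) fun t ht => hne hN t ht
      · intro t ht
        exact mul_div_cancel₀ _ (hne hN t ht)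
      · exact hi.div_ofReal_sub (by simpa using hN.ne')
    calc _ = ∫ x : ℝ, -(N * Complex.I) * (h x / ((x : ℂ) - N * Complex.I)) := by
          congr 1 with x
          ring
      _ = 0 := by rw [integral_const_mul, h0, mul_zero]
  have hlim : Tendsto (fun N : ℝ => ∫ x : ℝ, h x * (-(N * Complex.I) / (x - N * Complex.I)))
      atTop (𝓝 (∫ x : ℝ, h x)) := by
    refine tendsto_integral_filter_of_dominated_convergence (fun x => ‖h x‖) ?_ ?_ hi.norm ?_
    · filter_upwards [eventually_gt_atTop 0] with N hN
      refine hi.aestronglyMeasurable.mul (Continuous.aestronglyMeasurable ?_)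
      exact continuous_const.div (by fun_prop) fun x => hne hN x (by simp)
    · filter_upwards [eventually_gt_atTop 0] with N hN
      refine .of_forall fun x => ?_
      rw [norm_mul, norm_div]
      refine mul_le_of_le_one_right (norm_nonneg _) (div_le_one_of_le₀ ?_ (norm_nonneg _))
      have := Complex.abs_im_le_norm ((x : ℂ) - N * Complex.I)
      simpa using this
    · refine .of_forall fun x => ?_
      have hx : Tendsto (fun N : ℝ => (x : ℂ) * ((N⁻¹ : ℝ) : ℂ) * Complex.I + 1) atTop (𝓝 1) := by
        have := (Complex.continuous_ofReal.tendsto 0).comp tendsto_inv_atTop_zero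
        simpa [Function.comp_def] using
          ((this.const_mul (x : ℂ)).mul_const Complex.I).add_const 1
      have hx' := (hx.inv₀ one_ne_zero).const_mul (h x)
      rw [inv_one, mul_one] at hx'
      refine hx'.congr' ?_
      filter_upwards [eventually_gt_atTop 0] with N hN
      have hNc : (N : ℂ) ≠ 0 := by exact_mod_cast hN.ne'
      congr 1
      have e : (x : ℂ) * ((N⁻¹ : ℝ) : ℂ) * Complex.I + 1
          = (x - N * Complex.I) / (-(N * Complex.I)) := by
        have hI := Complex.I_ne_zero
        rw [eq_div_iff (by simp [hN.ne'])]
        push_cast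
        field_simp
        linear_combination (-(x : ℂ)) * Complex.I_sq
      rw [e, inv_div]
  refine tendsto_nhds_unique hlim (tendsto_const_nhds.congr' ?_)
  filter_upwards [eventually_gt_atTop 0] with N hN using (hzero N hN).symm

theorem sub_const_div (hg : HardyBelow 2 g) (c : ℂ) {w : ℂ} (hw : 0 < w.im) :
    HardyBelow 2 fun t => g t - c / (t - w) := by
  have hne : ∀ t : ℂ, t.im ≤ 0 → t - w ≠ 0 := fun t ht e => by
    have := congrArg Complex.im e
    simp at this
    linarith
  have hc : ContinuousOn (fun t => g t - c / (t - w)) {t | t.im ≤ 0} :=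
    hg.2.1.sub (continuousOn_const.div (by fun_prop) fun t ht => hne t ht)
  obtain ⟨M, hM⟩ := hg.exists_integral_sq_le
  refine ⟨hg.1.sub ((differentiableOn_const c).div (by fun_prop) fun t ht => hne t (le_of_lt ht)),
    hc, 2 * M + 2 * ‖c‖ ^ 2 * (Real.pi / w.im), fun y hy => ?_⟩
  simp only [Real.rpow_two]
  have h1 := (hM y hy).1
  have hv : y - w.im ≠ 0 := by linarith
  have h2 := integrable_inv_sub_sq_add_sq w.re hv
  have hi := (h1.const_mul 2).add (h2.const_mul (2 * ‖c‖ ^ 2))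
  have hle : ∀ x : ℝ, ‖g (x + y * Complex.I) - c / (x + y * Complex.I - w)‖ ^ 2 ≤
      2 * ‖g (x + y * Complex.I)‖ ^ 2 + 2 * ‖c‖ ^ 2 * ((x - w.re) ^ 2 + (y - w.im) ^ 2)⁻¹ := by
    intro x
    have e : ‖c / (x + y * Complex.I - w)‖ ^ 2
        = ‖c‖ ^ 2 * ((x - w.re) ^ 2 + (y - w.im) ^ 2)⁻¹ := by
      rw [norm_div, div_pow, Complex.norm_sub_sq, div_eq_mul_inv]
      simp
    rw [mul_assoc, ← e]
    have := norm_sub_le (g (x + y * Complex.I)) (c / (x + y * Complex.I - w))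
    nlinarith [sq_nonneg (‖g (x + y * Complex.I)‖ - ‖c / (x + y * Complex.I - w)‖),
      pow_le_pow_left₀ (norm_nonneg _) this 2]
  have hi' : Integrable fun x : ℝ => ‖g (x + y * Complex.I) - c / (x + y * Complex.I - w)‖ ^ 2 := by
    refine hi.mono' (Continuous.aestronglyMeasurable ?_) (.of_forall fun x => ?_)
    · refine ((hc.comp_continuous (f := fun x : ℝ => (x + y * Complex.I : ℂ)) (by fun_prop)
        fun x => ?_).norm).pow 2
      simpa using hy.le
    · rw [Real.norm_of_nonneg (by positivity)]
      exact hle x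
  refine ⟨hi', (integral_mono hi' hi hle).trans ?_⟩
  simp only [Pi.add_apply]
  rw [integral_add (h1.const_mul 2) (h2.const_mul _), integral_const_mul, integral_const_mul,
    integral_inv_sub_sq_add_sq _ hv, abs_of_neg (by linarith)]
  gcongr
  · exact (hM y hy).2
  · linarith

/-- Cauchy's integral formula for the lower half-plane. -/
theorem integral_div_sub (hg : HardyBelow 2 g) (hi : Integrable fun x : ℝ => g x) {z : ℂ}
    (hz : z.im < 0) : ∫ x : ℝ, g x / (x - z) = -(2 * Real.pi * Complex.I) * g z := by
  set w : ℂ := (starRingEnd ℂ) z with hwdef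
  have hw : 0 < w.im := by simpa [hwdef] using hz
  set c : ℂ := g z * (z - w) with hcdef
  have hzw : z - w ≠ 0 := fun e => by
    have := congrArg Complex.im e
    simp at this
    linarith
  set k : ℂ → ℂ := fun t => g t - c / (t - w) with hk
  have hkH : HardyBelow 2 k := hg.sub_const_div c hw
  have hkz : k z = 0 := by simp [hk, hcdef, hzw]
  have hopen : {t : ℂ | t.im < 0} ∈ 𝓝 z :=
    (isOpen_lt Complex.continuous_im continuous_const).mem_nhds hz
  have hclosed : {t : ℂ | t.im ≤ 0} ∈ 𝓝 z := mem_of_superset hopen fun t (ht : t.im < 0) => ht.le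
  have hsub : ∀ t, (t - z) * dslope k z t = k t := fun t => by
    simpa [hkz] using sub_smul_dslope k z t
  have hnum : ∀ x : ℝ, ((x : ℂ) - w) * (x - z) = (((x - z.re) ^ 2 + z.im ^ 2 : ℝ) : ℂ) := by
    intro x
    apply Complex.ext
    · rw [Complex.ofReal_re]
      simp [hwdef]
      ring
    · rw [Complex.ofReal_im]
      simp [hwdef]
      ring
  have hF : ∀ x : ℝ, dslope k z x
      = g x / (x - z) - c * ((((x - z.re) ^ 2 + z.im ^ 2)⁻¹ : ℝ) : ℂ) := by
    intro x
    have h1 := Complex.ofReal_sub_ne_zero hz.ne x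
    have h2 := Complex.ofReal_sub_ne_zero hw.ne' x
    rw [← mul_right_inj' h1, hsub, Complex.ofReal_inv, ← hnum]
    simp only [hk]
    field_simp
  have i1 := hi.div_ofReal_sub hz.ne
  have i2 : Integrable fun x : ℝ => c * ((((x - z.re) ^ 2 + z.im ^ 2)⁻¹ : ℝ) : ℂ) :=
    (integrable_inv_sub_sq_add_sq z.re hz.ne).ofReal.const_mul c
  have h0 : ∫ x : ℝ, dslope k z x = 0 := by
    refine hkH.integral_eq_zero ((Complex.differentiableOn_dslope hopen).mpr hkH.1)
      ((continuousOn_dslope hclosed).mpr ⟨hkH.2.1, hkH.1.differentiableAt hopen⟩)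
      (fun t _ => hsub t) ?_
    simp_rw [hF]
    exact i1.sub i2
  simp_rw [hF] at h0
  rw [integral_sub i1 i2, integral_const_mul, integral_complex_ofReal,
    integral_inv_sub_sq_add_sq _ hz.ne, abs_of_neg hz, sub_eq_zero] at h0
  rw [h0, hcdef]
  have hzi : (z.im : ℂ) ≠ 0 := by exact_mod_cast hz.ne
  have e : z - w = 2 * z.im * Complex.I := by
    rw [hwdef, Complex.sub_conj]
    push_cast
    ring
  rw [e]
  push_cast
  field_simp

end HardyBelow

/-- Generalized eigenvalue identity for the invariant mass-squared operator:
multiplication by the variable inside the Breit-Wigner integral pulls out the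
complex pole value `z_R`. -/
theorem hardyBelow_mass_squared_eigenvalue (g : ℂ → ℂ) (hg : HardyBelow 2 g)
    (hgS : ∃ ψ : SchwartzMap ℝ ℂ, ∀ x : ℝ, g ↑x = ψ x)
    (zR : ℂ) (hzR : zR.im < 0) :
    (∫ t : ℝ, ↑t * g ↑t / (↑t - zR) = -(2 * Real.pi * Complex.I) * zR * g zR) ∧
    (∫ t : ℝ, ↑t * g ↑t / (↑t - zR) = zR * ∫ t : ℝ, g ↑t / (↑t - zR)) := by
  obtain ⟨ψ, hψ⟩ := hgS
  have hi : Integrable fun x : ℝ => g x := by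
    simp_rw [hψ]
    exact ψ.integrable
  have hsplit : ∫ t : ℝ, ↑t * g ↑t / (↑t - zR) = zR * ∫ t : ℝ, g ↑t / (↑t - zR) := by
    have e : ∀ t : ℝ, (t : ℂ) * g t / (t - zR) = g t + zR * (g t / (t - zR)) := by
      intro t
      have := Complex.ofReal_sub_ne_zero hzR.ne t
      field_simp
      ring
    simp_rw [e]
    rw [integral_add hi ((hi.div_ofReal_sub hzR.ne).const_mul zR), integral_const_mul,
      hg.integral_ofReal_eq_zero hi, zero_add]
  refine ⟨?_, hsplit⟩
  rw [hsplit, hg.integral_div_sub hi hzR]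
  ring
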